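/- If θ : (F,+) → ℂ^× is an injective additive character, then the normalizer in GL(n-1,F) of the character Θ(u(x)) = θ(x_{n-1}) of U_n (i.e., the set of g with Θ(ι(g) u ι(g)^{-1}) = Θ(u) for all u ∈ U_n) equals the mirabolic subgroup P_{n-1} of matrices in GL(n-1,F) whose bottom row is (0,…,0,1). -/

import Mathlib

open scoped MatrixGroups

def uMat (F : Type*) [Field F] (m : ℕ) (x : Fin m → F) :
    Matrix (Fin (m + 1)) (Fin (m + 1)) F :=
  Matrix.of fun i j =>
    if i = j then 1
    else if hi : i = Fin.last m then 0
    else if j = Fin.last m then x (i.castPred hi) else 0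

def iotaMat (F : Type*) [Field F] (m : ℕ) (g : Matrix (Fin m) (Fin m) F) :
    Matrix (Fin (m + 1)) (Fin (m + 1)) F :=
  Matrix.of fun i j =>
    if hi : i = Fin.last m then (if j = Fin.last m then 1 else 0)
    else if hj : j = Fin.last m then 0
    else g (i.castPred hi) (j.castPred hj)

theorem uMat_mul_aux (F : Type*) [Field F] (m : ℕ) (x y : Fin m → F) :
    uMat F m x * uMat F m y = uMat F m (x + y) := by
  ext i j
  rw [Matrix.mul_apply, Fin.sum_univ_castSucc]
  refine Fin.lastCases ?_ (fun i => ?_) i <;> refine Fin.lastCases ?_ (fun j => ?_) j <;>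
    simp [uMat, Fin.castSucc_ne_last, (Fin.castSucc_ne_last _).symm, add_comm,
      Finset.sum_ite_eq, Fin.castSucc_inj]

theorem uMat_zero_aux (F : Type*) [Field F] (m : ℕ) : uMat F m 0 = 1 := by
  ext i j
  refine Fin.lastCases ?_ (fun i => ?_) i <;> refine Fin.lastCases ?_ (fun j => ?_) j <;>
    simp [uMat, Matrix.one_apply, Fin.castSucc_ne_last]

theorem iotaMat_mul_aux (F : Type*) [Field F] (m : ℕ) (g h : Matrix (Fin m) (Fin m) F) :
    iotaMat F m g * iotaMat F m h = iotaMat F m (g * h) := by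
  ext i j
  rw [Matrix.mul_apply, Fin.sum_univ_castSucc]
  refine Fin.lastCases ?_ (fun i => ?_) i <;> refine Fin.lastCases ?_ (fun j => ?_) j <;>
    simp [iotaMat, Fin.castSucc_ne_last, Matrix.mul_apply]

theorem iotaMat_one_aux (F : Type*) [Field F] (m : ℕ) : iotaMat F m 1 = 1 := by
  ext i j
  refine Fin.lastCases ?_ (fun i => ?_) i <;> refine Fin.lastCases ?_ (fun j => ?_) j <;>
    simp [iotaMat, Matrix.one_apply, Fin.castSucc_ne_last, (Fin.castSucc_ne_last _).symm]

theorem iotaMat_uMat_aux (F : Type*) [Field F] (m : ℕ) (g : Matrix (Fin m) (Fin m) F)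
    (x : Fin m → F) :
    iotaMat F m g * uMat F m x = uMat F m (g.mulVec x) * iotaMat F m g := by
  ext i j
  rw [Matrix.mul_apply, Matrix.mul_apply, Fin.sum_univ_castSucc, Fin.sum_univ_castSucc]
  refine Fin.lastCases ?_ (fun i => ?_) i <;> refine Fin.lastCases ?_ (fun j => ?_) j <;>
    simp [iotaMat, uMat, Fin.castSucc_ne_last, (Fin.castSucc_ne_last _).symm,
      Matrix.mulVec, dotProduct]

theorem uMat_entry_aux (F : Type*) [Field F] (m : ℕ) (x : Fin m → F) (i : Fin m) :
    uMat F m x i.castSucc (Fin.last m) = x i := by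
  simp [uMat, Fin.castSucc_ne_last]

theorem conj_entry_aux (F : Type*) [Field F] (m : ℕ) (g : Matrix (Fin m) (Fin m) F)
    (G U : GL (Fin (m + 1)) F) (x : Fin m → F)
    (hG : (G : Matrix (Fin (m + 1)) (Fin (m + 1)) F) = iotaMat F m g)
    (hU : (U : Matrix (Fin (m + 1)) (Fin (m + 1)) F) = uMat F m x) :
    ((G * U * G⁻¹ : GL (Fin (m + 1)) F) : Matrix (Fin (m + 1)) (Fin (m + 1)) F) =
      uMat F m (g.mulVec x) := by
  rw [Units.val_mul, Units.val_mul, hU]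
  have h := iotaMat_uMat_aux F m g x
  rw [← hG] at h
  rw [h, mul_assoc, Units.mul_inv, mul_one]

/-- For an injective additive character `θ`, the normalizer in `GL(n-1,F)` of the
character `Θ(u(x)) = θ(x_{n-1})` of `U_n` is the mirabolic subgroup `P_{n-1}`
(matrices with bottom row `(0,…,0,1)`).  Here `n = k+2 ≥ 3`. -/
theorem stmt4 (F : Type*) [Field F] (k : ℕ) (hk : 1 ≤ k)
    (θ : F → ℂˣ) (hθ : ∀ a b : F, θ (a + b) = θ a * θ b)
    (hinj : Function.Injective θ) :
    {g : GL (Fin (k + 1)) F |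
      ∀ G : GL (Fin (k + 2)) F,
        (G : Matrix (Fin (k + 2)) (Fin (k + 2)) F) =
          iotaMat F (k + 1) (g : Matrix (Fin (k + 1)) (Fin (k + 1)) F) →
        ∀ (U : GL (Fin (k + 2)) F) (x : Fin (k + 1) → F),
          (U : Matrix (Fin (k + 2)) (Fin (k + 2)) F) = uMat F (k + 1) x →
          θ (((G * U * G⁻¹ : GL (Fin (k + 2)) F) : Matrix (Fin (k + 2)) (Fin (k + 2)) F)
              (Fin.last k).castSucc (Fin.last (k + 1))) =
            θ (((U : GL (Fin (k + 2)) F) : Matrix (Fin (k + 2)) (Fin (k + 2)) F)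
              (Fin.last k).castSucc (Fin.last (k + 1)))} =
    {g : GL (Fin (k + 1)) F |
      ∀ j : Fin (k + 1), (g : Matrix (Fin (k + 1)) (Fin (k + 1)) F) (Fin.last k) j =
        if j = Fin.last k then 1 else 0} := by
  ext g
  simp only [Set.mem_setOf_eq]
  constructor
  · intro h j
    let G : GL (Fin (k + 2)) F :=
      ⟨iotaMat F (k + 1) g.val, iotaMat F (k + 1) g.inv,
        by rw [iotaMat_mul_aux, g.val_inv, iotaMat_one_aux],
        by rw [iotaMat_mul_aux, g.inv_val, iotaMat_one_aux]⟩
    let x : Fin (k + 1) → F := Pi.single j 1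
    let U : GL (Fin (k + 2)) F :=
      ⟨uMat F (k + 1) x, uMat F (k + 1) (-x),
        by rw [uMat_mul_aux, add_neg_cancel, uMat_zero_aux],
        by rw [uMat_mul_aux, neg_add_cancel, uMat_zero_aux]⟩
    have h1 := hinj (h G rfl U x rfl)
    rw [conj_entry_aux F (k + 1) g.val G U x rfl rfl, uMat_entry_aux,
      show (U : Matrix (Fin (k + 2)) (Fin (k + 2)) F) = uMat F (k + 1) x from rfl,
      uMat_entry_aux] at h1
    simpa [x, Pi.single_apply, eq_comm] using h1
  · intro h G hG U x hU
    rw [conj_entry_aux F (k + 1) g.val G U x hG hU, hU, uMat_entry_aux, uMat_entry_aux]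
    congr 1
    simp [Matrix.mulVec, dotProduct, h]
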